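/- Fix integers 0 ≤ k < n, let 0 < δ < 1 with 1/δ ∈ ℕ, z ∈ ℤⁿ, ρ ∈ Γ, 1 < p < ∞, and let w be a weight on Q_z. Let E be one of the sets E_{π_j} (the set of centers x_i whose selected k-face is parallel to the coordinate k-plane π_j), with |E| = v, and relabel the corresponding cells and fattened faces as Q_z(1),…,Q_z(v) and ℓ_1,…,ℓ_v. Suppose there is a constant 0 < K < ∞ such that for every choice of nonnegative numbers b_1,…,b_v with Σ_{i=1}^v b_i^{p'} = 1, setting t_i = (b_i/|ℓ_i|)·(∫_{Q_z(i)} w dx)^{1/p}, one has ‖Σ_{i=1}^v t_i·1_{ℓ_i}‖_{L^{p'}(7Q_z, w^{1−p'})} ≤ K. Then ‖\tilde M^k_{ρ,δ} f‖_{L^p(Ψ^{−1}(E), w)} ≤ K·‖f‖_{L^p(7Q_z, w)} for all f, where Ψ^{−1}(E) is the union of the cells Q_z(i) with x_i ∈ E. -/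

import Mathlib

open MeasureTheory Metric Set
open scoped ENNReal NNReal

noncomputable section

/-- Index of a `k`-face of an axis-parallel cube in `ℝⁿ`: a set of `k` "free" coordinates
together with a sign choice for the remaining coordinates (only the signs of coordinates
outside the free set matter). -/
abbrev FaceIdx (n k : ℕ) := {T : Finset (Fin n) // T.card = k} × (Fin n → Bool)

/-- The `k`-face of the axis-parallel cube centered at `x` with side length `2 r`
corresponding to the face index `F`. -/
def kFace {n : ℕ} (k : ℕ) (x : Fin n → ℝ) (r : ℝ) (F : FaceIdx n k) : Set (Fin n → ℝ) :=
  {y | (∀ i ∈ F.1.1, |y i - x i| ≤ r) ∧ ∀ i ∉ F.1.1, y i = x i + (if F.2 i then r else -r)}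

/-- The `δ`-neighborhood of a `k`-face. -/
def faceNbhd {n : ℕ} (k : ℕ) (δ : ℝ) (x : Fin n → ℝ) (r : ℝ) (F : FaceIdx n k) :
    Set (Fin n → ℝ) :=
  Metric.cthickening δ (kFace k x r F)

/-- The `δ`-neighborhood of the whole `k`-skeleton. -/
def skelNbhd {n : ℕ} (k : ℕ) (δ : ℝ) (x : Fin n → ℝ) (r : ℝ) : Set (Fin n → ℝ) :=
  ⋃ F : FaceIdx n k, faceNbhd k δ x r F

/-- The `k`-skeleton maximal function with width `δ` (with values in `ℝ≥0∞`):
`M^k_δ f (x) = sup_{1 ≤ r ≤ 2} min_j ⨍_{S^j_{k,δ}(x,r)} |f|`. -/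
def skelMax (n k : ℕ) (δ : ℝ) (f : (Fin n → ℝ) → ℝ) (x : Fin n → ℝ) : ℝ≥0∞ :=
  ⨆ r ∈ Set.Icc (1 : ℝ) 2, ⨅ F : FaceIdx n k,
    (volume (faceNbhd k δ x r F))⁻¹ * ∫⁻ y in faceNbhd k δ x r F, (‖f y‖₊ : ℝ≥0∞)

/-- `L^p` norm of an `ℝ≥0∞`-valued function. -/
def lpNormE {α : Type*} [MeasurableSpace α] (g : α → ℝ≥0∞) (p : ℝ) (μ : Measure α) : ℝ≥0∞ :=
  (∫⁻ x, g x ^ p ∂μ) ^ (1 / p)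

/-- The measure `w(x) dx` associated to a weight `w`. -/
def wMeasure {n : ℕ} (w : (Fin n → ℝ) → ℝ) : Measure (Fin n → ℝ) :=
  volume.withDensity fun x => ENNReal.ofReal (w x)

/-- Average of `g` over the set `A` (with respect to Lebesgue measure). -/
def ravg {n : ℕ} (A : Set (Fin n → ℝ)) (g : (Fin n → ℝ) → ℝ) : ℝ :=
  (volume A).toReal⁻¹ * ∫ y in A, g y

/-- The axis-parallel cube with center `c` and side length `s`. -/
def cube {n : ℕ} (c : Fin n → ℝ) (s : ℝ) : Set (Fin n → ℝ) :=
  {y | ∀ j, |y j - c j| ≤ s / 2}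

/-- The closed unit cube `Q_z` with lower-left vertex `z`. -/
def unitCube {n : ℕ} (z : Fin n → ℤ) : Set (Fin n → ℝ) :=
  {y | ∀ j, (z j : ℝ) ≤ y j ∧ y j ≤ (z j : ℝ) + 1}

/-- The cube `7 Q_z`: same center as `Q_z`, side length `7`. -/
def sevenCube {n : ℕ} (z : Fin n → ℤ) : Set (Fin n → ℝ) :=
  {y | ∀ j, |y j - ((z j : ℝ) + 1 / 2)| ≤ 7 / 2}

/-- The (half-open) grid cell `Q_z(m)` of side length `δ = 1/N` inside `Q_z`. -/
def gridCell {n : ℕ} (N : ℕ) (z : Fin n → ℤ) (m : Fin n → Fin N) : Set (Fin n → ℝ) :=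
  {y | ∀ j, (z j : ℝ) + (m j : ℝ) / N ≤ y j ∧ y j < (z j : ℝ) + ((m j : ℝ) + 1) / N}

/-- The center `x_m` of the grid cell `Q_z(m)`. -/
def gridCenter {n : ℕ} (N : ℕ) (z : Fin n → ℤ) (m : Fin n → Fin N) : Fin n → ℝ :=
  fun j => (z j : ℝ) + ((m j : ℝ) + 1 / 2) / N

/-- Membership in `Γ`: a radius function with values in `[1,2] ∩ δ ℤ`, `δ = 1/N`. -/
def inGamma {n : ℕ} (N : ℕ) (ρ : (Fin n → Fin N) → ℝ) : Prop :=
  ∀ m, ρ m ∈ Set.Icc (1 : ℝ) 2 ∧ ∃ t : ℤ, ρ m = (t : ℝ) / N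

/-- The `δ'`-neighborhood `ℓ_m` of the selected `k`-face of the skeleton
`S_k(x_m, ρ(x_m))`. -/
def selFace {n : ℕ} (k N : ℕ) (z : Fin n → ℤ) (ρ : (Fin n → Fin N) → ℝ)
    (sel : (Fin n → Fin N) → FaceIdx n k) (δ' : ℝ) (m : Fin n → Fin N) : Set (Fin n → ℝ) :=
  Metric.cthickening δ' (kFace k (gridCenter N z m) (ρ m) (sel m))

/-- The linearized `k`-skeleton maximal operator: on the cell `Q_z(m)` it equals the
average of `f` over the `δ'`-neighborhood of the selected face. -/
def linMax {n : ℕ} (k N : ℕ) (z : Fin n → ℤ) (ρ : (Fin n → Fin N) → ℝ)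
    (sel : (Fin n → Fin N) → FaceIdx n k) (δ' : ℝ) (f : (Fin n → ℝ) → ℝ)
    (x : Fin n → ℝ) : ℝ :=
  ∑ m : Fin n → Fin N, Set.indicator (gridCell N z m)
    (fun _ => (volume (selFace k N z ρ sel δ' m)).toReal⁻¹ *
      ∫ y in selFace k N z ρ sel δ' m, f y) x

/-- The local skeleton `A_p` constant `[w]_{A^{S_k}_{p,ρ,z}}` (for `1 < p < ∞`). -/
def ApLoc {n : ℕ} (k N : ℕ) (z : Fin n → ℤ) (ρ : (Fin n → Fin N) → ℝ)
    (sel : (Fin n → Fin N) → FaceIdx n k) (w : (Fin n → ℝ) → ℝ) (p : ℝ) : ℝ≥0∞ :=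
  ⨆ m : Fin n → Fin N,
    ((volume (selFace k N z ρ sel ((N : ℝ)⁻¹) m))⁻¹ *
        ∫⁻ y in gridCell N z m, ENNReal.ofReal (w y)) *
      ((volume (selFace k N z ρ sel ((N : ℝ)⁻¹) m))⁻¹ *
        ∫⁻ y in selFace k N z ρ sel ((N : ℝ)⁻¹) m,
          ENNReal.ofReal (w y) ^ (1 - p / (p - 1))) ^ (p - 1)

/-- The local skeleton `A_1` constant `[w]_{A^{S_k}_{1,ρ,z}}`. -/
def A1Loc {n : ℕ} (k N : ℕ) (z : Fin n → ℤ) (ρ : (Fin n → Fin N) → ℝ)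
    (sel : (Fin n → Fin N) → FaceIdx n k) (w : (Fin n → ℝ) → ℝ) : ℝ≥0∞ :=
  ⨆ m : Fin n → Fin N,
    ((volume (selFace k N z ρ sel ((N : ℝ)⁻¹) m))⁻¹ *
        ∫⁻ y in gridCell N z m, ENNReal.ofReal (w y)) *
      essSup (fun y => (ENNReal.ofReal (w y))⁻¹)
        (volume.restrict (selFace k N z ρ sel ((N : ℝ)⁻¹) m))

/-- The global skeleton `A_p` constant `[w]_{A^{S_k}_p}` (with the `A_1` version at `p = 1`). -/
def ApGlobal {n : ℕ} (k N : ℕ)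
    (sel : (Fin n → ℤ) → ((Fin n → Fin N) → ℝ) → (Fin n → Fin N) → FaceIdx n k)
    (w : (Fin n → ℝ) → ℝ) (p : ℝ) : ℝ≥0∞ :=
  if p = 1 then
    ⨆ z : Fin n → ℤ, ⨆ ρ : {ρ : (Fin n → Fin N) → ℝ // inGamma N ρ},
      A1Loc k N z ρ.1 (sel z ρ.1) w
  else
    ⨆ z : Fin n → ℤ, ⨆ ρ : {ρ : (Fin n → Fin N) → ℝ // inGamma N ρ},
      ApLoc k N z ρ.1 (sel z ρ.1) w p

/-- Hölder's inequality in the weighted form dual to `L^p(W)`. Where the weight vanishes,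
`W ^ (1 - q) = ∞`, so finiteness of the second factor forces `g = 0` almost everywhere there. -/
theorem lintegral_mul_le_weighted_Lp_mul_Lq {α : Type*} [MeasurableSpace α] {μ : Measure α}
    {p q : ℝ} (hpq : p.HolderConjugate q) {W F g : α → ℝ≥0∞} (hW : AEMeasurable W μ)
    (hW_top : ∀ x, W x ≠ ∞) (hF : AEMeasurable F μ) (hg : AEMeasurable g μ)
    (hfin : ∫⁻ x, W x ^ (1 - q) * g x ^ q ∂μ ≠ ∞) :
    ∫⁻ x, F x * g x ∂μ ≤
      (∫⁻ x, W x * F x ^ p ∂μ) ^ (1 / p) * (∫⁻ x, W x ^ (1 - q) * g x ^ q ∂μ) ^ (1 / q) := by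
  have hp := hpq.pos
  have hq := hpq.symm.pos
  have hq1 := hpq.symm.lt
  have hae : ∀ᵐ x ∂μ, W x ^ (1 - q) * g x ^ q < ∞ :=
    ae_lt_top' ((hW.pow_const _).mul (hg.pow_const _)) hfin
  calc ∫⁻ x, F x * g x ∂μ
      = ∫⁻ x, ((fun x => W x ^ (1 / p) * F x) * fun x => W x ^ (-(1 / p)) * g x) x ∂μ := by
        refine lintegral_congr_ae ?_
        filter_upwards [hae] with x hx
        simp only [Pi.mul_apply]
        by_cases h0 : W x = 0
        · have hg0 : g x = 0 := by
            by_contra hne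
            rw [h0, ENNReal.zero_rpow_of_neg (by linarith), ENNReal.top_mul] at hx
            · exact lt_irrefl _ hx
            · simp [ENNReal.rpow_eq_zero_iff, hne, hq.not_gt]
          simp [hg0]
        · have h1 : W x ^ (1 / p) * W x ^ (-(1 / p)) = 1 := by
            rw [← ENNReal.rpow_add _ _ h0 (hW_top x)]; simp
          rw [mul_mul_mul_comm, h1, one_mul]
    _ ≤ _ := ENNReal.lintegral_mul_le_Lp_mul_Lq μ hpq ((hW.pow_const _).mul hF)
        ((hW.pow_const _).mul hg)
    _ = _ := by
        have hexp : -(1 / p) * q = 1 - q := by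
          have := hpq.symm.sub_one_mul_conj
          field_simp
          linarith
        congr 2
        · refine lintegral_congr fun x => ?_
          rw [ENNReal.mul_rpow_of_nonneg _ _ hp.le, ← ENNReal.rpow_mul,
            one_div_mul_cancel hp.ne', ENNReal.rpow_one]
        · refine lintegral_congr fun x => ?_
          rw [ENNReal.mul_rpow_of_nonneg _ _ hq.le, ← ENNReal.rpow_mul, hexp]

/-- The extremal vector in the duality between `ℓ^p` and `ℓ^q` over a finite set. -/
theorem exists_Lp_dual_vector {ι : Type*} (s : Finset ι) {p q : ℝ} (hpq : p.HolderConjugate q)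
    {a : ι → ℝ} (ha : ∀ i, 0 ≤ a i) (hs : 0 < ∑ i ∈ s, a i ^ p) :
    ∃ b : ι → ℝ, (∀ i, 0 ≤ b i) ∧ ∑ i ∈ s, b i ^ q = 1 ∧
      ∑ i ∈ s, a i * b i = (∑ i ∈ s, a i ^ p) ^ (1 / p) := by
  set T := ∑ i ∈ s, a i ^ p with hT
  have hp := hpq.pos
  have hpp : ∀ i, a i * a i ^ (p - 1) = a i ^ p := fun i => by
    rcases (ha i).eq_or_lt with h | h
    · rw [← h, Real.zero_rpow hp.ne', zero_mul]
    · rw [Real.rpow_sub_one h.ne']; field_simp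
  refine ⟨fun i => a i ^ (p - 1) * T ^ (-(1 / q)), fun i => ?_, ?_, ?_⟩
  · have := ha i; positivity
  · have : ∀ i, (a i ^ (p - 1) * T ^ (-(1 / q))) ^ q = a i ^ p * T⁻¹ := fun i => by
      rw [Real.mul_rpow (Real.rpow_nonneg (ha i) _) (by positivity), ← Real.rpow_mul (ha i),
        ← Real.rpow_mul hs.le, hpq.sub_one_mul_conj, neg_mul,
        one_div_mul_cancel hpq.symm.pos.ne', Real.rpow_neg_one]
    simp only [this]
    rw [← Finset.sum_mul, ← hT, mul_inv_cancel₀ hs.ne']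
  · simp only [← mul_assoc, hpp]
    rw [← Finset.sum_mul, ← hT]
    nth_rewrite 1 [← Real.rpow_one T]
    rw [← Real.rpow_add hs]
    congr 1
    have := hpq.inv_add_inv_eq_one
    simp only [one_div]
    linarith

theorem eLpNorm_withDensity_restrict {α : Type*} [MeasurableSpace α] {μ : Measure α}
    {D : α → ℝ≥0∞} (hD : AEMeasurable D μ) {s : Set α} (hs : MeasurableSet s) {g : α → ℝ}
    (hg : AEMeasurable g (μ.restrict s)) {p : ℝ} (hp : 0 < p) :
    eLpNorm g (ENNReal.ofReal p) ((μ.withDensity D).restrict s) =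
      (∫⁻ x in s, D x * ‖g x‖ₑ ^ p ∂μ) ^ (1 / p) := by
  rw [eLpNorm_eq_lintegral_rpow_enorm_toReal (by simpa using hp) ENNReal.ofReal_ne_top,
    ENNReal.toReal_ofReal hp.le, restrict_withDensity hs,
    lintegral_withDensity_eq_lintegral_mul₀' hD.restrict]
  · rfl
  · exact (hg.enorm.pow_const p).mono_ac (withDensity_absolutelyContinuous _ _)

section Grid

variable {n : ℕ} {N : ℕ} {z : Fin n → ℤ}

theorem measurableSet_gridCell (m : Fin n → Fin N) : MeasurableSet (gridCell N z m) := by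
  have : gridCell N z m = Set.pi univ fun j =>
      Set.Ico ((z j : ℝ) + (m j : ℝ) / N) ((z j : ℝ) + ((m j : ℝ) + 1) / N) := by
    ext y; simp [gridCell, Set.mem_pi]
  rw [this]
  exact MeasurableSet.univ_pi fun j => measurableSet_Ico

theorem measurableSet_sevenCube : MeasurableSet (sevenCube z) := by
  have : sevenCube z = Metric.closedBall (fun j => (z j : ℝ) + 1 / 2) (7 / 2) := by
    ext y
    rw [Metric.mem_closedBall, dist_pi_le_iff (by norm_num)]
    rfl
  rw [this]
  exact measurableSet_closedBall

theorem gridCell_subset_Icc (m : Fin n → Fin N) :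
    gridCell N z m ⊆ Set.Icc (fun j => (z j : ℝ) + (m j : ℝ) / N)
      (fun j => (z j : ℝ) + ((m j : ℝ) + 1) / N) :=
  fun _ hy => ⟨fun j => (hy j).1, fun j => (hy j).2.le⟩

theorem eq_of_mem_gridCell {m m' : Fin n → Fin N} {y : Fin n → ℝ}
    (h : y ∈ gridCell N z m) (h' : y ∈ gridCell N z m') : m = m' := by
  funext j
  have hN : (0 : ℝ) < N := by exact_mod_cast (Nat.zero_le _).trans_lt (m j).2
  have key : ∀ a b : Fin n → Fin N, y ∈ gridCell N z a → y ∈ gridCell N z b →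
      (a j : ℕ) ≤ b j := fun a b ha hb => by
    have h1 : ((a j : ℕ) : ℝ) / N < (((b j : ℕ) : ℝ) + 1) / N := by
      linarith [(ha j).1, (hb j).2]
    rw [div_lt_div_iff_of_pos_right hN] at h1
    exact Nat.lt_succ_iff.mp (by exact_mod_cast h1)
  exact Fin.ext (le_antisymm (key m m' h h') (key m' m h' h))

theorem selFace_subset_sevenCube (k : ℕ) {ρ : (Fin n → Fin N) → ℝ} (hρ : inGamma N ρ)
    (sel : (Fin n → Fin N) → FaceIdx n k) {δ : ℝ} (hδ0 : 0 ≤ δ) (hδ1 : δ ≤ 1)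
    (m : Fin n → Fin N) : selFace k N z ρ sel δ m ⊆ sevenCube z := by
  have hsub : kFace k (gridCenter N z m) (ρ m) (sel m) ⊆
      Metric.closedBall (fun j => (z j : ℝ) + 1 / 2) (5 / 2) := by
    intro y hy
    rw [Metric.mem_closedBall, dist_pi_le_iff (by norm_num)]
    intro j
    obtain ⟨hr1, hr2⟩ := (hρ m).1
    have hN : (0 : ℝ) < N := by exact_mod_cast (Nat.zero_le _).trans_lt (m j).2
    have hmj : ((m j : ℕ) : ℝ) + 1 ≤ N := by exact_mod_cast (m j).2
    have hc : |gridCenter N z m j - ((z j : ℝ) + 1 / 2)| ≤ 1 / 2 := by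
      have h0 : 0 ≤ (((m j : ℕ) : ℝ) + 1 / 2) / N := by positivity
      have h1 : (((m j : ℕ) : ℝ) + 1 / 2) / N ≤ 1 := by
        rw [div_le_one hN]; linarith
      rw [abs_le]
      constructor <;> simp only [gridCenter] <;> linarith
    have hy' : |y j - gridCenter N z m j| ≤ ρ m := by
      by_cases hj : j ∈ (sel m).1.1
      · exact hy.1 j hj
      · rw [hy.2 j hj, abs_le]
        split_ifs <;> constructor <;> linarith
    rw [Real.dist_eq]
    have := abs_sub_le (y j) (gridCenter N z m j) ((z j : ℝ) + 1 / 2)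
    linarith
  intro y hy
  have h1 := (Metric.cthickening_subset_of_subset δ hsub) hy
  rw [cthickening_closedBall hδ0 (by norm_num), Metric.mem_closedBall,
    dist_pi_le_iff (by positivity)] at h1
  intro j
  have := h1 j
  rw [Real.dist_eq] at this
  linarith

theorem linMax_of_mem_gridCell {k : ℕ} {ρ : (Fin n → Fin N) → ℝ}
    {sel : (Fin n → Fin N) → FaceIdx n k} {δ : ℝ} {f : (Fin n → ℝ) → ℝ} {x : Fin n → ℝ}
    {m : Fin n → Fin N} (hx : x ∈ gridCell N z m) :
    linMax k N z ρ sel δ f x = (volume (selFace k N z ρ sel δ m)).toReal⁻¹ *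
      ∫ y in selFace k N z ρ sel δ m, f y := by
  rw [linMax, Finset.sum_eq_single m, Set.indicator_of_mem hx]
  · intro m' _ hne
    exact Set.indicator_of_notMem (fun h => hne (eq_of_mem_gridCell h hx)) _
  · simp

/-- The weighted `L^p` norm of `linMax` over a union of grid cells, as an `ℓ^p` sum. -/
theorem eLpNorm_linMax {k : ℕ} {ρ : (Fin n → Fin N) → ℝ}
    {sel : (Fin n → Fin N) → FaceIdx n k} {δ : ℝ} {f w : (Fin n → ℝ) → ℝ} {p : ℝ} (hp : 0 < p)
    (hw0 : ∀ x, 0 ≤ w x) (hw : LocallyIntegrable w volume) (E : Finset (Fin n → Fin N)) :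
    eLpNorm (linMax k N z ρ sel δ f) (ENNReal.ofReal p)
        ((wMeasure w).restrict (⋃ m ∈ E, gridCell N z m)) =
      ENNReal.ofReal ((∑ m ∈ E, ((volume (selFace k N z ρ sel δ m)).toReal⁻¹ *
        |∫ y in selFace k N z ρ sel δ m, f y| *
          (∫ x in gridCell N z m, w x) ^ (1 / p)) ^ p) ^ (1 / p)) := by
  have hW0 : ∀ m, 0 ≤ ∫ x in gridCell N z m, w x := fun m => integral_nonneg hw0
  have hmass : ∀ m, wMeasure w (gridCell N z m) =
      ENNReal.ofReal (∫ x in gridCell N z m, w x) := fun m => by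
    rw [wMeasure, withDensity_apply _ (measurableSet_gridCell m),
      ofReal_integral_eq_lintegral_ofReal _ (ae_of_all _ hw0)]
    exact (hw.integrableOn_isCompact isCompact_Icc).mono_set (gridCell_subset_Icc m)
  have hterm : ∀ m, 0 ≤ ((volume (selFace k N z ρ sel δ m)).toReal⁻¹ *
      |∫ y in selFace k N z ρ sel δ m, f y| *
        (∫ x in gridCell N z m, w x) ^ (1 / p)) ^ p := fun m => by
    have := hW0 m; positivity
  rw [eLpNorm_eq_lintegral_rpow_enorm_toReal (by simpa using hp) ENNReal.ofReal_ne_top,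
    ENNReal.toReal_ofReal hp.le, lintegral_biUnion_finset,
    ← ENNReal.ofReal_rpow_of_nonneg (Finset.sum_nonneg fun m _ => hterm m)
      (by positivity), ENNReal.ofReal_sum_of_nonneg (fun m _ => hterm m)]
  · congr 1
    refine Finset.sum_congr rfl fun m _ => ?_
    rw [setLIntegral_congr_fun (measurableSet_gridCell m)
      (fun x hx => by rw [linMax_of_mem_gridCell hx]), setLIntegral_const, hmass,
      Real.mul_rpow (by positivity) (Real.rpow_nonneg (hW0 m) _), ← Real.rpow_mul (hW0 m),
      one_div_mul_cancel hp.ne', Real.rpow_one, ENNReal.ofReal_mul (by positivity),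
      ← ENNReal.ofReal_rpow_of_nonneg (by positivity) hp.le, Real.enorm_eq_ofReal_abs,
      abs_mul, abs_of_nonneg (inv_nonneg.mpr ENNReal.toReal_nonneg)]
  · intro m _ m' _ hne
    exact Set.disjoint_left.mpr fun y h h' => hne (eq_of_mem_gridCell h h')
  · exact fun m _ => measurableSet_gridCell m

end Grid

/-- `n`-dimensional version of the duality reduction: from an
`L^{p'}(7Q_z, w^{1-p'})` bound for admissible sums of indicators of the selected fattened
`k`-faces parallel to a fixed coordinate `k`-plane `π` (spanned by the coordinates in `T₀`),
one obtains the `L^p(w)` bound for `M̃^k_{ρ,δ}` on `Ψ⁻¹(E_π)`. -/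
theorem dual_to_maximal_k (n k : ℕ) (hkn : k < n) (N : ℕ) (hN : 1 < N) (δ : ℝ)
    (hδ : δ = (N : ℝ)⁻¹) (z : Fin n → ℤ) (ρ : (Fin n → Fin N) → ℝ) (hρ : inGamma N ρ)
    (sel : (Fin n → Fin N) → FaceIdx n k) (p : ℝ) (hp : 1 < p)
    (w : (Fin n → ℝ) → ℝ) (hw0 : ∀ x, 0 ≤ w x) (hw : LocallyIntegrable w volume)
    (T₀ : Finset (Fin n)) (hT₀ : T₀.card = k)
    (K : ℝ) (hK : 0 < K)
    (hdual : ∀ b : (Fin n → Fin N) → ℝ, (∀ m, 0 ≤ b m) →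
      (∑ m ∈ Finset.univ.filter (fun m => (sel m).1.1 = T₀), b m ^ (p / (p - 1)) = 1) →
      eLpNorm
        (fun y => ∑ m ∈ Finset.univ.filter (fun m => (sel m).1.1 = T₀),
          b m / (volume (selFace k N z ρ sel δ m)).toReal *
            (∫ x in gridCell N z m, w x) ^ (1 / p) *
            Set.indicator (selFace k N z ρ sel δ m) (fun _ => (1 : ℝ)) y)
        (ENNReal.ofReal (p / (p - 1)))
        ((volume.withDensity fun y => ENNReal.ofReal (w y) ^ (1 - p / (p - 1))).restrict
          (sevenCube z)) ≤ ENNReal.ofReal K) :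
    ∀ f : (Fin n → ℝ) → ℝ,
      eLpNorm (linMax k N z ρ sel δ f) (ENNReal.ofReal p)
          ((wMeasure w).restrict
            (⋃ m ∈ Finset.univ.filter (fun m => (sel m).1.1 = T₀), gridCell N z m)) ≤
        ENNReal.ofReal K *
          eLpNorm f (ENNReal.ofReal p) ((wMeasure w).restrict (sevenCube z)) := by
  intro f
  have hpq : p.HolderConjugate (p / (p - 1)) := Real.HolderConjugate.conjExponent hp
  set q := p / (p - 1)
  set E := Finset.univ.filter (fun m => (sel m).1.1 = T₀)
  rw [eLpNorm_linMax hpq.pos hw0 hw E]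
  set ℓ := selFace k N z ρ sel δ
  have hN1 : (1 : ℝ) < N := by exact_mod_cast hN
  have hℓ_sub : ∀ m, ℓ m ⊆ sevenCube z := selFace_subset_sevenCube k hρ sel
    (by rw [hδ]; positivity) (by rw [hδ]; exact inv_le_one_of_one_le₀ hN1.le)
  have hℓ_meas : ∀ m, MeasurableSet (ℓ m) := fun m => Metric.isClosed_cthickening.measurableSet
  clear_value ℓ
  have hw_meas : AEMeasurable w volume := hw.aestronglyMeasurable.aemeasurable
  have hW0 : ∀ m, 0 ≤ ∫ x in gridCell N z m, w x := fun m => integral_nonneg hw0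
  set a : (Fin n → Fin N) → ℝ := fun m => (volume (ℓ m)).toReal⁻¹ *
    |∫ y in ℓ m, f y| * (∫ x in gridCell N z m, w x) ^ (1 / p) with ha
  have ha0 : ∀ m, 0 ≤ a m := fun m => by have := hW0 m; positivity
  change ENNReal.ofReal ((∑ m ∈ E, a m ^ p) ^ (1 / p)) ≤ _
  rcases (Finset.sum_nonneg fun m _ => Real.rpow_nonneg (ha0 m) p :
    0 ≤ ∑ m ∈ E, a m ^ p).eq_or_lt with hS | hS
  · rw [← hS, Real.zero_rpow (one_div_ne_zero hpq.pos.ne')]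
    simp
  obtain ⟨b, hb0, hb1, hab⟩ := exists_Lp_dual_vector E hpq ha0 hS
  have hK' := hdual b hb0 hb1
  set t : (Fin n → Fin N) → ℝ := fun m =>
    b m / (volume (ℓ m)).toReal * (∫ x in gridCell N z m, w x) ^ (1 / p) with ht
  have ht0 : ∀ m, 0 ≤ t m := fun m => by have := hW0 m; have := hb0 m; positivity
  set g : (Fin n → ℝ) → ℝ := fun y => ∑ m ∈ E, t m * (ℓ m).indicator (fun _ => (1 : ℝ)) y
    with hg
  change eLpNorm g _ _ ≤ _ at hK'
  have hg_meas : Measurable g := Finset.measurable_fun_sum _ fun m _ =>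
    (measurable_const.indicator (hℓ_meas m)).const_mul _
  have hg_enorm : ∀ y, ‖g y‖ₑ = ∑ m ∈ E, ENNReal.ofReal (t m) *
      (ℓ m).indicator (fun _ => (1 : ℝ≥0∞)) y := fun y => by
    have hi : ∀ m, 0 ≤ (ℓ m).indicator (fun _ => (1 : ℝ)) y := fun m =>
      Set.indicator_nonneg (fun _ _ => zero_le_one) y
    rw [Real.enorm_of_nonneg (Finset.sum_nonneg fun m _ => mul_nonneg (ht0 m) (hi m)),
      ENNReal.ofReal_sum_of_nonneg (fun m _ => mul_nonneg (ht0 m) (hi m))]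
    refine Finset.sum_congr rfl fun m _ => ?_
    rw [ENNReal.ofReal_mul (ht0 m)]
    by_cases hy : y ∈ ℓ m <;> simp [hy]
  rw [eLpNorm_withDensity_restrict (hw_meas.ennreal_ofReal.pow_const _) measurableSet_sevenCube
    hg_meas.aemeasurable hpq.symm.pos] at hK'
  -- Faces over which `f` is not integrable contribute nothing, so only the others matter.
  set U : Set (Fin n → ℝ) := ⋃ m : {m // IntegrableOn f (ℓ m)}, ℓ m with hU
  have hU_meas : MeasurableSet U := MeasurableSet.iUnion fun m => hℓ_meas m
  have hf_meas : AEMeasurable (U.indicator f) volume := by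
    rw [aemeasurable_indicator_iff hU_meas, hU, aemeasurable_iUnion_iff]
    exact fun m => m.2.aestronglyMeasurable.aemeasurable
  have hpair : ∀ m, ENNReal.ofReal (a m * b m) ≤
      ENNReal.ofReal (t m) * ∫⁻ y in ℓ m, ‖U.indicator f y‖ₑ := fun m => by
    by_cases hm : IntegrableOn f (ℓ m)
    · have hsub : ℓ m ⊆ U := fun y hy => Set.mem_iUnion.mpr ⟨⟨m, hm⟩, hy⟩
      have h1 : a m * b m = t m * |∫ y in ℓ m, f y| := by
        simp only [ha, ht]; ring
      rw [h1, ENNReal.ofReal_mul (ht0 m), ← Real.enorm_eq_ofReal_abs,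
        setLIntegral_congr_fun (hℓ_meas m)
          (fun y hy => by rw [Set.indicator_of_mem (hsub hy)])]
      gcongr
      exact enorm_integral_le_lintegral_enorm _
    · have h0 : a m = 0 := by
        simp only [ha]
        rw [integral_undef hm]; simp
      simp [h0]
  calc ENNReal.ofReal ((∑ m ∈ E, a m ^ p) ^ (1 / p))
      = ∑ m ∈ E, ENNReal.ofReal (a m * b m) := by
        rw [← hab, ENNReal.ofReal_sum_of_nonneg fun m _ => mul_nonneg (ha0 m) (hb0 m)]
    _ ≤ ∑ m ∈ E, ENNReal.ofReal (t m) * ∫⁻ y in ℓ m, ‖U.indicator f y‖ₑ :=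
        Finset.sum_le_sum fun m _ => hpair m
    _ = ∫⁻ y in sevenCube z, ‖U.indicator f y‖ₑ * ‖g y‖ₑ := by
        simp only [hg_enorm, Finset.mul_sum]
        have hterm : ∀ m ∈ E, AEMeasurable (fun y => ‖U.indicator f y‖ₑ *
            (ENNReal.ofReal (t m) * (ℓ m).indicator (fun _ => (1 : ℝ≥0∞)) y))
            (volume.restrict (sevenCube z)) := fun m _ => hf_meas.enorm.restrict.mul
          ((measurable_const.indicator (hℓ_meas m)).const_mul _).aemeasurable
        rw [lintegral_finsetSum' _ hterm]
        refine Finset.sum_congr rfl fun m _ => ?_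
        rw [← lintegral_const_mul' _ _ ENNReal.ofReal_ne_top, ← lintegral_indicator (hℓ_meas m),
          ← setLIntegral_eq_of_support_subset (s := sevenCube z)]
        · refine lintegral_congr fun y => ?_
          by_cases hy : y ∈ ℓ m <;> simp [hy, mul_comm]
        · exact Set.support_indicator_subset.trans (hℓ_sub m)
    _ ≤ _ := lintegral_mul_le_weighted_Lp_mul_Lq hpq hw_meas.ennreal_ofReal.restrict
        (fun _ => ENNReal.ofReal_ne_top) hf_meas.enorm.restrict
        hg_meas.enorm.aemeasurable (fun h => by
          rw [h, ENNReal.top_rpow_of_pos (by have := hpq.symm.pos; positivity)] at hK'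
          exact ENNReal.ofReal_ne_top (top_le_iff.mp hK'))
    _ ≤ _ := mul_le_mul' le_rfl hK'
    _ = ENNReal.ofReal K * eLpNorm (U.indicator f) (ENNReal.ofReal p)
          ((wMeasure w).restrict (sevenCube z)) := by
        rw [mul_comm, wMeasure, eLpNorm_withDensity_restrict hw_meas.ennreal_ofReal
          measurableSet_sevenCube hf_meas.restrict hpq.pos]
    _ ≤ _ := mul_le_mul' le_rfl (eLpNorm_indicator_le f)

end
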